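/- arXiv:1112.0128 — 3 statements merged into one kernel-verified Lean document; each statement's English description precedes it below -/
import Mathlib

section
/- Let n ≥ 2 and let p be a prime. Define ψ₀ : ℕ → [0,∞) by ψ₀(q) = p^{-1} if p divides q and ψ₀(q) = 0 otherwise. Then μ_p(W_p(ψ₀, ℚ, n)) = 1 − (p−1)^n / (p^n − 1). In particular 0 < μ_p(W_p(ψ₀, ℚ, n)) < 1, so no zero-one law holds without a condition on ψ at multiples of p. -/
open MeasureTheory

noncomputable section

/-- The p-adic projective distance (at vector level): the sup-norm of the wedge product
divided by the product of sup norms.  Invariant under scaling, it descends to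
projective space. -/
def padicDelta (p : ℕ) [Fact p.Prime] {n : ℕ} (x y : Fin n → ℚ_[p]) : ℝ :=
  (⨆ ij : Fin n × Fin n, ‖x ij.1 * y ij.2 - x ij.2 * y ij.1‖) / (‖x‖ * ‖y‖)

instance (p : ℕ) [Fact p.Prime] (n : ℕ) : MeasurableSpace (Fin n → ℚ_[p]) := borel _
instance (p : ℕ) [Fact p.Prime] (n : ℕ) : BorelSpace (Fin n → ℚ_[p]) := ⟨rfl⟩

/-- `ℤ_p^n` as a positive compact subset of `ℚ_p^n`. -/
def padicUnitPC (p : ℕ) [Fact p.Prime] (n : ℕ) :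
    TopologicalSpace.PositiveCompacts (Fin n → ℚ_[p]) where
  carrier := {x | ∀ i, ‖x i‖ ≤ 1}
  isCompact' := by
    have : {x : Fin n → ℚ_[p] | ∀ i, ‖x i‖ ≤ 1} = Set.univ.pi fun _ => Metric.closedBall 0 1 := by
      ext x; simp [Metric.mem_closedBall, dist_eq_norm]
    rw [this]
    exact isCompact_univ_pi fun i => isCompact_closedBall 0 1
  interior_nonempty' := by
    refine ⟨0, ?_⟩
    rw [mem_interior]
    refine ⟨Metric.ball 0 1, fun x hx i => ?_, Metric.isOpen_ball, by simp⟩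
    have hx' : ‖x‖ < 1 := by simpa [dist_eq_norm] using hx
    exact le_of_lt (lt_of_le_of_lt (norm_le_pi_norm x i) hx')

/-- Haar measure on `ℚ_p^n`, normalized so that `ℤ_p^n` has measure one. -/
def padicHaar (p : ℕ) [Fact p.Prime] (n : ℕ) : Measure (Fin n → ℚ_[p]) :=
  Measure.addHaarMeasure (padicUnitPC p n)

/-- The natural probability measure `μ_p` on `ℙ^{n-1}(ℚ_p)`:
`μ_p(M) = β(φ⁻¹(M) ∩ ℤ_p^n)`. -/
def muP (p : ℕ) [Fact p.Prime] (n : ℕ)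
    (M : Set (Projectivization ℚ_[p] (Fin n → ℚ_[p]))) : ENNReal :=
  padicHaar p n {x | (∀ i, ‖x i‖ ≤ 1) ∧ ∃ hx : x ≠ 0, Projectivization.mk ℚ_[p] x hx ∈ M}

/-- A visible (primitive) integer vector: the gcd of its coordinates is 1. -/
def IsPrim {n : ℕ} (v : Fin n → ℤ) : Prop := Finset.univ.gcd v = 1

/-- The sup-norm height of an integer vector. -/
def Hsup {n : ℕ} (v : Fin n → ℤ) : ℕ := Finset.univ.sup fun i => (v i).natAbs

/-- Embedding of an integer vector into `ℚ_p^n`. -/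
def intPadic (p : ℕ) [Fact p.Prime] {n : ℕ} (v : Fin n → ℤ) : Fin n → ℚ_[p] :=
  fun i => ((v i : ℤ) : ℚ_[p])

/-- Embedding of an integer vector into `ℚ^n`. -/
def intRat {n : ℕ} (v : Fin n → ℤ) : Fin n → ℚ := fun i => ((v i : ℤ) : ℚ)

/-- The set `W_p(ψ, ℚ, n)` of points of `ℙ^{n-1}(ℚ_p)` admitting infinitely many
rational approximations `y` with `δ_p(x,y) ≤ ψ(H(y))`. -/
def Wp (p : ℕ) [Fact p.Prime] (n : ℕ) (ψ : ℕ → ℝ) :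
    Set (Projectivization ℚ_[p] (Fin n → ℚ_[p])) :=
  {x | {y : Projectivization ℚ (Fin n → ℚ) | ∃ v : Fin n → ℤ, IsPrim v ∧
      (∃ hv : intRat v ≠ 0, y = Projectivization.mk ℚ (intRat v) hv) ∧
      padicDelta p x.rep (intPadic p v) ≤ ψ (Hsup v)}.Infinite}

/-- Closed ball for the projective metric, centered at the class of the vector `y`. -/
def Bdelta (p : ℕ) [Fact p.Prime] {n : ℕ} (y : Fin n → ℚ_[p]) (r : ℝ) :
    Set (Projectivization ℚ_[p] (Fin n → ℚ_[p])) :=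
  {z | padicDelta p z.rep y ≤ r}

/-- The Euclidean norm of a vector in `ℝ^n`. -/
noncomputable def eNorm {n : ℕ} (x : Fin n → ℝ) : ℝ := Real.sqrt (∑ i, (x i) ^ 2)

/-- Norm of the wedge product of two vectors in `ℝ^n`:
`‖x ∧ y‖² = Σ_{i<j} (x_i y_j − x_j y_i)²`. -/
noncomputable def wedgeNorm {n : ℕ} (x y : Fin n → ℝ) : ℝ :=
  Real.sqrt (∑ ij ∈ Finset.univ.filter (fun ij : Fin n × Fin n => ij.1 < ij.2),
    (x ij.1 * y ij.2 - x ij.2 * y ij.1) ^ 2)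

/-- The projective distance at the infinite place (vector level):
`δ_∞(x,y) = ‖x ∧ y‖ / (‖x‖‖y‖)`. Invariant under scaling, it descends to `ℙ^{n-1}(ℝ)`. -/
noncomputable def deltaInf {n : ℕ} (x y : Fin n → ℝ) : ℝ :=
  wedgeNorm x y / (eNorm x * eNorm y)

/-- Embedding of an integer vector into `ℝ^n`. -/
noncomputable def intReal {n : ℕ} (v : Fin n → ℤ) : Fin n → ℝ := fun i => ((v i : ℤ) : ℝ)

/-- The natural probability measure `μ_∞` on `ℙ^{n-1}(ℝ)`:
`μ_∞(M) = λ(φ⁻¹(M) ∩ B(0,1)) / λ(B(0,1))`. -/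
noncomputable def muInf (n : ℕ) (M : Set (Projectivization ℝ (Fin n → ℝ))) : ENNReal :=
  MeasureTheory.volume {x : Fin n → ℝ | eNorm x ≤ 1 ∧
      ∃ hx : x ≠ 0, Projectivization.mk ℝ x hx ∈ M} /
    MeasureTheory.volume {x : Fin n → ℝ | eNorm x ≤ 1}

/-- The set `W_∞(ψ, ℚ, n)` of points of `ℙ^{n-1}(ℝ)` admitting infinitely many
rational approximations `y` with `δ_∞(x,y) ≤ ψ(H(y))`. -/
noncomputable def Winf (n : ℕ) (ψ : ℕ → ℝ) : Set (Projectivization ℝ (Fin n → ℝ)) :=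
  {x | {y : Projectivization ℚ (Fin n → ℚ) | ∃ v : Fin n → ℤ, IsPrim v ∧
      (∃ hv : intRat v ≠ 0, y = Projectivization.mk ℚ (intRat v) hv) ∧
      deltaInf x.rep (intReal v) ≤ ψ (Hsup v)}.Infinite}

/-- The Choi–Vaaler constant `c(n) = 2·π^{-1/2}·Γ(n/2+1)^{1/n}` for `k = ℚ`. -/
noncomputable def cCV (n : ℕ) : ℝ :=
  2 * Real.pi ^ (-(1/2 : ℝ)) * Real.Gamma ((n : ℝ) / 2 + 1) ^ ((1 : ℝ) / n)

/-- The Euclidean height of a primitive integer vector. -/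
noncomputable def He {n : ℕ} (v : Fin n → ℤ) : ℝ := eNorm (intReal v)

end

section PadicBasics

variable {p : ℕ} [Fact p.Prime] {n : ℕ}

theorem Padic.norm_sub_le_max (x y : ℚ_[p]) : ‖x - y‖ ≤ max ‖x‖ ‖y‖ := by
  simpa [sub_eq_add_neg] using IsUltrametricDist.norm_add_le_max x (-y)

theorem Padic.norm_lt_one_iff_le_inv (x : ℚ_[p]) : ‖x‖ < 1 ↔ ‖x‖ ≤ (p : ℝ)⁻¹ := by
  have h := Padic.norm_le_pow_iff_norm_lt_pow_add_one x (-1)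
  rw [zpow_neg_one] at h
  simpa using h.symm

theorem exists_norm_apply_eq {x : Fin n → ℚ_[p]} (hx : x ≠ 0) : ∃ j, ‖x j‖ = ‖x‖ := by
  obtain ⟨i, -⟩ := Function.ne_iff.1 hx
  have : Nonempty (Fin n) := ⟨i⟩
  obtain ⟨j, hj⟩ := Finite.exists_max fun i => ‖x i‖
  exact ⟨j, (norm_le_pi_norm x j).antisymm ((pi_norm_le_iff_of_nonneg (norm_nonneg _)).2 hj)⟩

theorem IsPrim.exists_not_dvd {v : Fin n → ℤ} (hv : IsPrim v) : ∃ j, ¬ (p : ℤ) ∣ v j := by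
  by_contra! h
  have h1 : (p : ℤ) ∣ Finset.univ.gcd v := Finset.dvd_gcd fun j _ => h j
  rw [IsPrim] at hv
  rw [hv] at h1
  exact (Nat.prime_iff_prime_int.1 (Fact.out : p.Prime)).not_isUnit (isUnit_of_dvd_one h1)

theorem IsPrim.norm_intPadic {v : Fin n → ℤ} (hv : IsPrim v) : ‖intPadic p v‖ = 1 := by
  obtain ⟨j, hj⟩ := hv.exists_not_dvd (p := p)
  refine le_antisymm ((pi_norm_le_iff_of_nonneg zero_le_one).2 fun i =>
    Padic.norm_int_le_one (v i)) ?_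
  refine le_trans (not_lt.1 ?_) (norm_le_pi_norm _ j)
  rwa [intPadic, Padic.norm_intCast_lt_one_iff]

theorem padicDelta_le_iff {x : Fin n → ℚ_[p]} (hx : x ≠ 0) {v : Fin n → ℤ} (hv : IsPrim v)
    {r : ℝ} : padicDelta p x (intPadic p v) ≤ r ↔
      ∀ i j, ‖x i * v j - x j * v i‖ ≤ r * ‖x‖ := by
  obtain ⟨i, -⟩ := Function.ne_iff.1 hx
  have : Nonempty (Fin n × Fin n) := ⟨(i, i)⟩
  rw [padicDelta, hv.norm_intPadic, mul_one, div_le_iff₀ (norm_pos_iff.2 hx),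
    ciSup_le_iff (Set.finite_range _).bddAbove]
  exact Prod.forall

theorem exists_natAbs_eq_Hsup [Nonempty (Fin n)] (v : Fin n → ℤ) :
    ∃ i, (v i).natAbs = Hsup v := by
  obtain ⟨i, -, hi⟩ := Finset.exists_mem_eq_sup Finset.univ Finset.univ_nonempty
    fun i => (v i).natAbs
  exact ⟨i, hi.symm⟩

theorem mk_intRat_eq_of_mul_eq {v w : Fin n → ℤ} (hv : intRat v ≠ 0) (hw : intRat w ≠ 0)
    (h : ∀ i j, v i * w j = v j * w i) :
    Projectivization.mk ℚ (intRat v) hv = Projectivization.mk ℚ (intRat w) hw := by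
  obtain ⟨j, hj⟩ := Function.ne_iff.1 hw
  rw [Projectivization.mk_eq_mk_iff']
  refine ⟨intRat v j / intRat w j, funext fun i => ?_⟩
  have h2 : intRat v i * intRat w j = intRat v j * intRat w i := by
    simp only [intRat]; exact_mod_cast h i j
  have h3 : intRat w j ≠ 0 := hj
  rw [Pi.smul_apply, smul_eq_mul, div_mul_eq_mul_div, ← h2, mul_div_cancel_right₀ _ h3]

theorem mul_eq_of_mk_intRat_eq {v w : Fin n → ℤ} {hv : intRat v ≠ 0} {hw : intRat w ≠ 0}
    (h : Projectivization.mk ℚ (intRat v) hv = Projectivization.mk ℚ (intRat w) hw) (i j : Fin n) :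
    v i * w j = v j * w i := by
  rw [Projectivization.mk_eq_mk_iff'] at h
  obtain ⟨a, ha⟩ := h
  have h1 : ∀ k, a * (w k : ℚ) = v k := fun k => congrFun ha k
  have h2 : (v i : ℚ) * w j = v j * w i := by rw [← h1, ← h1]; ring
  exact_mod_cast h2

end PadicBasics

section Approximation

variable {p : ℕ} [Fact p.Prime] {n : ℕ}

/-- At most one rational point lies at distance `0` from a given `p`-adic point. -/
theorem subsingleton_delta_nonpos {x : Fin n → ℚ_[p]} (hx : x ≠ 0) :
    {y : Projectivization ℚ (Fin n → ℚ) | ∃ v : Fin n → ℤ, IsPrim v ∧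
      (∃ hv : intRat v ≠ 0, y = Projectivization.mk ℚ (intRat v) hv) ∧
      padicDelta p x (intPadic p v) ≤ 0}.Subsingleton := by
  rintro _ ⟨v, hv, ⟨hv0, rfl⟩, hxv⟩ _ ⟨w, hw, ⟨hw0, rfl⟩, hxw⟩
  rw [padicDelta_le_iff hx hv] at hxv
  rw [padicDelta_le_iff hx hw] at hxw
  simp only [zero_mul, norm_le_zero_iff, sub_eq_zero] at hxv hxw
  obtain ⟨k, hk⟩ := Function.ne_iff.1 hx
  have hk : x k ≠ 0 := hk
  refine mk_intRat_eq_of_mul_eq hv0 hw0 fun i j => ?_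
  have h : (v i * w j : ℚ_[p]) = v j * w i := by
    refine mul_left_cancel₀ (mul_ne_zero hk hk) ?_
    calc x k * x k * (v i * w j) = (x k * v i) * (x k * w j) := by ring
      _ = (x k * v j) * (x k * w i) := by rw [hxv k i, hxw k j, hxv k j, hxw k i]; ring
      _ = _ := by ring
  exact_mod_cast h

theorem exists_norm_lt_of_infinite {x : Fin n → ℚ_[p]} (hx : x ≠ 0)
    (h : {y : Projectivization ℚ (Fin n → ℚ) | ∃ v : Fin n → ℤ, IsPrim v ∧
      (∃ hv : intRat v ≠ 0, y = Projectivization.mk ℚ (intRat v) hv) ∧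
      padicDelta p x (intPadic p v) ≤ if p ∣ Hsup v then (p : ℝ)⁻¹ else 0}.Infinite) :
    ∃ i, ‖x i‖ < ‖x‖ := by
  by_contra! hx'
  have hx' : ∀ i, ‖x i‖ = ‖x‖ := fun i => (norm_le_pi_norm x i).antisymm (hx' i)
  have hpos : 0 < ‖x‖ := norm_pos_iff.2 hx
  refine h ((subsingleton_delta_nonpos hx).finite.subset ?_)
  rintro y ⟨v, hv, hy, hd⟩
  refine ⟨v, hv, hy, ?_⟩
  split_ifs at hd with hH
  swap
  · exact hd
  exfalso
  obtain ⟨j, hj⟩ := hv.exists_not_dvd (p := p)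
  have : Nonempty (Fin n) := ⟨j⟩
  obtain ⟨i, hi⟩ := exists_natAbs_eq_Hsup v
  rw [← hi, ← Int.natCast_dvd] at hH
  rw [padicDelta_le_iff hx hv] at hd
  have hp1 : (p : ℝ)⁻¹ * ‖x‖ < ‖x‖ :=
    mul_lt_of_lt_one_left hpos (inv_lt_one_of_one_lt₀ (by
      exact_mod_cast (Fact.out : p.Prime).one_lt))
  have h1 : ‖x j * v i‖ < ‖x‖ := by
    rw [norm_mul, hx']
    exact mul_lt_of_lt_one_right hpos (Padic.norm_intCast_lt_one_iff.2 hH)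
  have h2 : ‖x i * v j‖ = ‖x‖ := by
    rw [norm_mul, hx', (Padic.norm_int_le_one (v j)).antisymm
      (not_lt.1 (mt Padic.norm_intCast_lt_one_iff.1 hj)), mul_one]
  have h3 := IsUltrametricDist.norm_add_le_max (x i * v j - x j * v i) (x j * v i)
  rw [sub_add_cancel, h2] at h3
  exact absurd h3 (not_le.2 (max_lt ((hd i j).trans_lt hp1) h1))

theorem exists_natCast_approx {z : ℚ_[p]} (hz : ‖z‖ ≤ 1) :
    ∃ a : ℕ, a < p ∧ ‖z - a‖ ≤ (p : ℝ)⁻¹ := by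
  obtain ⟨w, rfl⟩ : ∃ w : ℤ_[p], (w : ℚ_[p]) = z := ⟨⟨z, hz⟩, rfl⟩
  refine ⟨w.zmodRepr, w.zmodRepr_lt_p, ?_⟩
  rw [← Padic.norm_lt_one_iff_le_inv]
  have h := w.norm_sub_zmodRepr_lt_one
  rwa [PadicInt.norm_def, PadicInt.coe_sub, PadicInt.coe_natCast] at h

theorem infinite_of_norm_lt {x : Fin n → ℚ_[p]} {i : Fin n} (hi : ‖x i‖ < ‖x‖) :
    {y : Projectivization ℚ (Fin n → ℚ) | ∃ v : Fin n → ℤ, IsPrim v ∧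
      (∃ hv : intRat v ≠ 0, y = Projectivization.mk ℚ (intRat v) hv) ∧
      padicDelta p x (intPadic p v) ≤ if p ∣ Hsup v then (p : ℝ)⁻¹ else 0}.Infinite := by
  have hpos : 0 < ‖x‖ := (norm_nonneg _).trans_lt hi
  have hx : x ≠ 0 := norm_pos_iff.1 hpos
  have hp : p.Prime := Fact.out
  obtain ⟨j, hj⟩ := exists_norm_apply_eq hx
  have hij : j ≠ i := by rintro rfl; exact hi.ne hj
  have hxj : x j ≠ 0 := norm_pos_iff.1 (hj ▸ hpos)
  have hz : ∀ k, ‖x k / x j‖ ≤ 1 := fun k => by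
    rw [norm_div, hj]; exact div_le_one_of_le₀ (norm_le_pi_norm x k) hpos.le
  choose a ha_lt ha using fun k => exists_natCast_approx (hz k)
  let v : ℕ → Fin n → ℤ := fun m k =>
    if k = i then (p * (m + 1) : ℕ) else if k = j then 1 else a k
  have hvi : ∀ m, v m i = (p * (m + 1) : ℕ) := fun m => by simp [v]
  have hvj : ∀ m, v m j = 1 := fun m => by simp [v, hij]
  have hprim : ∀ m, IsPrim (v m) := fun m => by
    have h1 : Finset.univ.gcd (v m) ∣ 1 := hvj m ▸ Finset.gcd_dvd (Finset.mem_univ j)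
    rw [IsPrim, ← Finset.normalize_gcd]
    exact normalize_eq_one.2 (isUnit_of_dvd_one h1)
  have hv0 : ∀ m, intRat (v m) ≠ 0 := fun m h => by
    have := congrFun h j
    simp [intRat, hvj] at this
  have hH : ∀ m, Hsup (v m) = p * (m + 1) := fun m => by
    refine le_antisymm (Finset.sup_le fun k _ => ?_) ?_
    · have hpm : p ≤ p * (m + 1) := Nat.le_mul_of_pos_right p m.succ_pos
      simp only [v]
      split_ifs
      · exact le_rfl
      · exact hp.one_le.trans hpm
      · exact (ha_lt k).le.trans hpm
    · exact (congrArg Int.natAbs (hvi m)).ge.trans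
        (Finset.le_sup (f := fun k => (v m k).natAbs) (Finset.mem_univ i))
  have happ : ∀ m k, ‖x k / x j - v m k‖ ≤ (p : ℝ)⁻¹ := fun m k => by
    simp only [v]
    split_ifs with h1 h2
    · subst h1
      rw [← Padic.norm_lt_one_iff_le_inv]
      refine (Padic.norm_sub_le_max _ _).trans_lt (max_lt ?_ ?_)
      · rw [norm_div, hj]; exact (div_lt_one hpos).2 hi
      · rw [Padic.norm_intCast_lt_one_iff]
        exact_mod_cast dvd_mul_right p (m + 1)
    · subst h2
      simp [hxj]
    · exact_mod_cast ha k
  refine Set.infinite_of_injective_forall_mem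
    (f := fun m => Projectivization.mk ℚ (intRat (v m)) (hv0 m)) (fun m m' hmm => ?_) fun m => ?_
  · have h := mul_eq_of_mk_intRat_eq hmm i j
    rw [hvi, hvi, hvj, hvj, mul_one, one_mul] at h
    have h := Nat.eq_of_mul_eq_mul_left hp.pos (Int.ofNat_inj.1 h)
    omega
  · refine ⟨v m, hprim m, ⟨hv0 m, rfl⟩, ?_⟩
    rw [hH, if_pos (dvd_mul_right _ _), padicDelta_le_iff hx (hprim m)]
    intro k l
    have e : x k * v m l - x l * v m k =
        ((x k / x j - v m k) * v m l - (x l / x j - v m l) * v m k) * x j := by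
      field_simp; ring
    have hb : ∀ k l, ‖(x k / x j - v m k) * v m l‖ ≤ (p : ℝ)⁻¹ := fun k l => by
      rw [norm_mul]
      exact (mul_le_of_le_one_right (norm_nonneg _) (Padic.norm_int_le_one _)).trans (happ m k)
    rw [e, norm_mul, hj]
    gcongr
    exact (Padic.norm_sub_le_max _ _).trans (max_le (hb k l) (hb l k))

theorem mk_mem_Wp_iff {x : Fin n → ℚ_[p]} (hx : x ≠ 0) :
    Projectivization.mk ℚ_[p] x hx ∈ Wp p n (fun q => if p ∣ q then (p : ℝ)⁻¹ else 0) ↔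
      ∃ i, ‖x i‖ < ‖x‖ := by
  obtain ⟨a, ha⟩ := Projectivization.exists_smul_eq_mk_rep ℚ_[p] x hx
  have hr := (Projectivization.mk ℚ_[p] x hx).rep_nonzero
  have hscale : ∀ i, ‖(Projectivization.mk ℚ_[p] x hx).rep i‖ <
      ‖(Projectivization.mk ℚ_[p] x hx).rep‖ ↔ ‖x i‖ < ‖x‖ := fun i => by
    have ha0 : 0 < ‖(a : ℚ_[p])‖ := norm_pos_iff.2 a.ne_zero
    rw [← ha, Units.smul_def, Pi.smul_apply, norm_smul, norm_smul, mul_lt_mul_iff_right₀ ha0]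
  rw [← exists_congr hscale]
  exact ⟨exists_norm_lt_of_infinite hr, fun ⟨_, hi⟩ => infinite_of_norm_lt hi⟩

end Approximation

section Measure

open scoped Pointwise

variable {p : ℕ} [Fact p.Prime] {n : ℕ}

/-- The vectors of `ℤ_p^n` with reduction `r` modulo `p`. -/
def residueClass (p : ℕ) [Fact p.Prime] {n : ℕ} (r : Fin n → ZMod p) : Set (Fin n → ℚ_[p]) :=
  {x | ∀ i, ‖x i - ((r i).val : ℚ_[p])‖ < 1}

theorem measurableSet_residueClass (r : Fin n → ZMod p) : MeasurableSet (residueClass p r) := by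
  refine IsOpen.measurableSet ?_
  simp only [residueClass, Set.ofPred_forall]
  exact isOpen_iInter_of_finite fun i => isOpen_lt (by fun_prop) continuous_const

theorem norm_natCast_val_sub_lt_one_iff {a b : ZMod p} :
    ‖((a.val : ℚ_[p]) - b.val)‖ < 1 ↔ a = b := by
  have h : ((a.val : ℚ_[p]) - b.val) = (((a.val : ℤ) - b.val : ℤ) : ℚ_[p]) := by push_cast; rfl
  rw [h, Padic.norm_intCast_lt_one_iff, ← ZMod.intCast_zmod_eq_zero_iff_dvd]
  simp [sub_eq_zero]

theorem pairwiseDisjoint_residueClass (S : Set (Fin n → ZMod p)) :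
    S.PairwiseDisjoint (residueClass p) := by
  refine fun r _ s _ hrs => Set.disjoint_left.2 fun x hr hs => hrs (funext fun i => ?_)
  rw [← norm_natCast_val_sub_lt_one_iff, ← sub_sub_sub_cancel_left _ _ (x i)]
  exact (Padic.norm_sub_le_max _ _).trans_lt (max_lt (hs i) (hr i))

theorem exists_mem_residueClass {x : Fin n → ℚ_[p]} (hx : ∀ i, ‖x i‖ ≤ 1) :
    ∃ r, x ∈ residueClass p r := by
  choose a ha_lt ha using fun i => exists_natCast_approx (hx i)
  refine ⟨fun i => a i, fun i => ?_⟩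
  rw [ZMod.val_natCast_of_lt (ha_lt i), Padic.norm_lt_one_iff_le_inv]
  exact ha i

theorem norm_le_one_of_mem_residueClass {r : Fin n → ZMod p} {x : Fin n → ℚ_[p]}
    (hx : x ∈ residueClass p r) (i : Fin n) : ‖x i‖ ≤ 1 := by
  have h := IsUltrametricDist.norm_add_le_max (x i - ((r i).val : ℚ_[p])) ((r i).val : ℚ_[p])
  rw [sub_add_cancel] at h
  exact h.trans (max_le (hx i).le (by exact_mod_cast Padic.norm_int_le_one ((r i).val : ℤ)))

theorem norm_lt_one_iff_of_mem_residueClass {r : Fin n → ZMod p} {x : Fin n → ℚ_[p]}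
    (hx : x ∈ residueClass p r) (i : Fin n) : ‖x i‖ < 1 ↔ r i = 0 := by
  rw [← norm_natCast_val_sub_lt_one_iff, ZMod.val_zero, Nat.cast_zero, sub_zero]
  constructor <;> intro h
  · have := Padic.norm_sub_le_max (x i) (x i - ((r i).val : ℚ_[p]))
    rw [sub_sub_cancel] at this
    exact this.trans_lt (max_lt h (hx i))
  · have := IsUltrametricDist.norm_add_le_max (x i - ((r i).val : ℚ_[p])) ((r i).val : ℚ_[p])
    rw [sub_add_cancel] at this
    exact this.trans_lt (max_lt (hx i) h)

instance : (padicHaar p n).IsAddHaarMeasure := by unfold padicHaar; infer_instance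

instance : (padicHaar p n).Regular := by unfold padicHaar; infer_instance

theorem padicHaar_unitBall : padicHaar p n {x | ∀ i, ‖x i‖ ≤ 1} = 1 :=
  Measure.addHaarMeasure_self (K₀ := padicUnitPC p n)

theorem padicHaar_residueClass (r : Fin n → ZMod p) :
    padicHaar p n (residueClass p r) = padicHaar p n (residueClass p (0 : Fin n → ZMod p)) := by
  rw [← measure_preimage_add (padicHaar p n) (fun i => ((r i).val : ℚ_[p])) (residueClass p r)]
  congr 1
  ext x
  simp [residueClass]

theorem padicHaar_biUnion_residueClass (S : Finset (Fin n → ZMod p)) :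
    padicHaar p n (⋃ r ∈ S, residueClass p r) =
      S.card * padicHaar p n (residueClass p (0 : Fin n → ZMod p)) := by
  rw [measure_biUnion_finset (pairwiseDisjoint_residueClass _)
    fun r _ => measurableSet_residueClass r]
  simp [padicHaar_residueClass]

theorem pow_mul_padicHaar_residueClass_zero :
    (p : ENNReal) ^ n * padicHaar p n (residueClass p (0 : Fin n → ZMod p)) = 1 := by
  have h := padicHaar_biUnion_residueClass (p := p) (n := n) Finset.univ
  have e : (⋃ r ∈ (Finset.univ : Finset (Fin n → ZMod p)), residueClass p r) =
      {x | ∀ i, ‖x i‖ ≤ 1} := by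
    ext x
    simp only [Finset.mem_univ, Set.iUnion_true, Set.mem_iUnion]
    exact ⟨fun ⟨r, hr⟩ => norm_le_one_of_mem_residueClass hr, exists_mem_residueClass⟩
  rw [e, padicHaar_unitBall] at h
  simpa using h.symm

theorem pow_mul_padicHaar_units :
    (p : ENNReal) ^ n * padicHaar p n {x | ∀ i, ‖x i‖ = 1} = ((p - 1 : ℕ) : ENNReal) ^ n := by
  have e : {x : Fin n → ℚ_[p] | ∀ i, ‖x i‖ = 1} =
      ⋃ r ∈ Fintype.piFinset fun _ : Fin n => (Finset.univ.erase (0 : ZMod p)),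
        residueClass p r := by
    ext x
    simp only [Set.mem_iUnion, Fintype.mem_piFinset, Finset.mem_erase, Finset.mem_univ, and_true,
      exists_prop]
    constructor
    · intro h
      obtain ⟨r, hr⟩ := exists_mem_residueClass fun i => (h i).le
      exact ⟨r, fun i => mt (norm_lt_one_iff_of_mem_residueClass hr i).2 (h i).not_lt, hr⟩
    · rintro ⟨r, hr0, hr⟩ i
      exact (norm_le_one_of_mem_residueClass hr i).antisymm
        (not_lt.1 (mt (norm_lt_one_iff_of_mem_residueClass hr i).1 (hr0 i)))
  rw [e, padicHaar_biUnion_residueClass, mul_left_comm, pow_mul_padicHaar_residueClass_zero]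
  simp [Finset.card_erase_of_mem, ZMod.card]

/-- The element `p` of `ℚ_p` as a unit. -/
noncomputable def padicUniformizer (p : ℕ) [hp : Fact p.Prime] : ℚ_[p]ˣ :=
  Units.mk0 p (Nat.cast_ne_zero.2 hp.out.ne_zero)

theorem mem_padicUniformizer_smul_iff {S : Set (Fin n → ℚ_[p])} {x : Fin n → ℚ_[p]} :
    x ∈ padicUniformizer p • S ↔ (p : ℚ_[p])⁻¹ • x ∈ S := by
  rw [Set.mem_smul_set_iff_inv_smul_mem]
  rfl

theorem pow_mul_padicHaar_smul (S : Set (Fin n → ℚ_[p])) :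
    (p : ENNReal) ^ n * padicHaar p n (padicUniformizer p • S) = padicHaar p n S := by
  have e : padicUniformizer p • {x : Fin n → ℚ_[p] | ∀ i, ‖x i‖ ≤ 1} =
      residueClass p (0 : Fin n → ZMod p) := by
    ext x
    have hp : (0 : ℝ) < p := Nat.cast_pos.2 (Fact.out : p.Prime).pos
    rw [mem_padicUniformizer_smul_iff]
    simp [residueClass, Padic.norm_lt_one_iff_le_inv, ← one_div,
      le_div_iff₀' hp]
  have h1 := distribHaarChar_mul (padicHaar p n) (padicUniformizer p) {x | ∀ i, ‖x i‖ ≤ 1}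
  rw [e, padicHaar_unitBall, mul_one] at h1
  rw [← distribHaarChar_mul, h1, ← mul_assoc, pow_mul_padicHaar_residueClass_zero, one_mul]

/-- The vectors of `ℤ_p^n` all of whose coordinates have the same absolute value. -/
def equinormSet (p : ℕ) [Fact p.Prime] (n : ℕ) : Set (Fin n → ℚ_[p]) :=
  {x | ‖x‖ ≤ 1 ∧ ∀ i, ‖x i‖ = ‖x‖}

theorem measurableSet_equinormSet : MeasurableSet (equinormSet p n) := by
  refine IsClosed.measurableSet ?_
  simp only [equinormSet, Set.ofPred_and, Set.ofPred_forall]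
  exact (isClosed_le continuous_norm continuous_const).inter
    (isClosed_iInter fun i => isClosed_eq (by fun_prop) continuous_norm)

theorem equinormSet_eq_union [Nonempty (Fin n)] :
    equinormSet p n = {x | ∀ i, ‖x i‖ = 1} ∪ padicUniformizer p • equinormSet p n := by
  have hp : (0 : ℝ) < p := Nat.cast_pos.2 (Fact.out : p.Prime).pos
  have hp1 : (p : ℝ)⁻¹ < 1 := inv_lt_one_of_one_lt₀ (by
      exact_mod_cast (Fact.out : p.Prime).one_lt)
  ext x
  rw [Set.mem_union, mem_padicUniformizer_smul_iff]
  simp only [equinormSet, Set.mem_ofPred_eq, Pi.smul_apply, norm_smul, norm_inv,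
    Padic.norm_p, inv_inv, mul_right_inj' hp.ne']
  obtain ⟨i⟩ := ‹Nonempty (Fin n)›
  constructor
  · rintro ⟨h1, h⟩
    refine (eq_or_lt_of_le h1).imp (fun h2 j => (h j).trans h2) fun h2 => ⟨?_, h⟩
    rw [← h i, Padic.norm_lt_one_iff_le_inv] at h2
    rw [← h i]
    simpa [hp.ne'] using mul_le_mul_of_nonneg_left h2 hp.le
  · rintro (h | ⟨h1, h⟩)
    · have h1 : ‖x‖ = 1 := le_antisymm ((pi_norm_le_iff_of_nonneg zero_le_one).2 fun j => (h j).le)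
        ((h i).ge.trans (norm_le_pi_norm x i))
      exact ⟨h1.le, fun j => (h j).trans h1.symm⟩
    · rw [← le_div_iff₀' hp, one_div] at h1
      exact ⟨h1.trans hp1.le, h⟩

theorem disjoint_units_smul_equinormSet [Nonempty (Fin n)] :
    Disjoint {x : Fin n → ℚ_[p] | ∀ i, ‖x i‖ = 1} (padicUniformizer p • equinormSet p n) := by
  refine Set.disjoint_left.2 fun x h1 h2 => ?_
  rw [mem_padicUniformizer_smul_iff] at h2
  obtain ⟨i⟩ := ‹Nonempty (Fin n)›
  have h3 := (norm_le_pi_norm _ i).trans h2.1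
  rw [Pi.smul_apply, norm_smul, h1 i, mul_one, norm_inv, Padic.norm_p, inv_inv] at h3
  exact absurd h3 (not_le.2 (by exact_mod_cast (Fact.out : p.Prime).one_lt))

theorem equinormSet_subset : equinormSet p n ⊆ {x | ∀ i, ‖x i‖ ≤ 1} :=
  fun x hx i => (norm_le_pi_norm x i).trans hx.1

theorem padicHaar_equinormSet_ne_top : padicHaar p n (equinormSet p n) ≠ ⊤ :=
  ((measure_mono equinormSet_subset).trans_lt
    (padicHaar_unitBall.trans_lt ENNReal.one_lt_top)).ne

theorem pow_mul_padicHaar_equinormSet [Nonempty (Fin n)] :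
    (p : ENNReal) ^ n * padicHaar p n (equinormSet p n) =
      ((p - 1 : ℕ) : ENNReal) ^ n + padicHaar p n (equinormSet p n) := by
  have hm : MeasurableSet {x : Fin n → ℚ_[p] | ∀ i, ‖x i‖ = 1} := by
    refine IsClosed.measurableSet ?_
    simp only [Set.ofPred_forall]
    exact isClosed_iInter fun i => isClosed_eq (by fun_prop) continuous_const
  conv_lhs => rw [equinormSet_eq_union, measure_union' disjoint_units_smul_equinormSet hm]
  rw [mul_add, pow_mul_padicHaar_units, pow_mul_padicHaar_smul]

theorem padicHaar_equinormSet (hn : n ≠ 0) :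
    padicHaar p n (equinormSet p n) = ((p : ENNReal) - 1) ^ n / ((p : ENNReal) ^ n - 1) := by
  have : Nonempty (Fin n) := ⟨⟨0, Nat.pos_of_ne_zero hn⟩⟩
  have hp : 1 < p := (Fact.out : p.Prime).one_lt
  have hpn : (1 : ENNReal) < (p : ENNReal) ^ n := by exact_mod_cast Nat.one_lt_pow hn hp
  rw [ENNReal.eq_div_iff (tsub_pos_of_lt hpn).ne' (by finiteness), ENNReal.sub_mul
    fun _ _ => padicHaar_equinormSet_ne_top, one_mul, pow_mul_padicHaar_equinormSet,
    ENNReal.add_sub_cancel_right padicHaar_equinormSet_ne_top]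
  simp

theorem muP_Wp (hn : n ≠ 0) :
    muP p n (Wp p n (fun q => if p ∣ q then (p : ℝ)⁻¹ else 0)) =
      1 - ((p : ENNReal) - 1) ^ n / ((p : ENNReal) ^ n - 1) := by
  rw [← padicHaar_equinormSet hn, ← padicHaar_unitBall (p := p) (n := n),
    ← measure_sdiff equinormSet_subset measurableSet_equinormSet.nullMeasurableSet
      padicHaar_equinormSet_ne_top, muP]
  congr 1
  ext x
  simp only [Set.mem_ofPred_eq, mk_mem_Wp_iff, Set.mem_sdiff, equinormSet, not_and, not_forall]
  refine and_congr_right fun hx => ?_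
  have hx1 : ‖x‖ ≤ 1 := (pi_norm_le_iff_of_nonneg zero_le_one).2 hx
  constructor
  · rintro ⟨-, i, hi⟩ -
    exact ⟨i, hi.ne⟩
  · intro h
    obtain ⟨i, hi⟩ := h hx1
    have hi := (norm_le_pi_norm x i).lt_of_ne hi
    exact ⟨norm_pos_iff.1 ((norm_nonneg _).trans_lt hi), i, hi⟩

end Measure

theorem Nat.pred_pow_add_one_lt_pow {p n : ℕ} (hp : 2 ≤ p) (hn : 2 ≤ n) :
    (p - 1) ^ n + 1 < p ^ n := by
  obtain ⟨q, rfl⟩ : ∃ q, p = q + 1 := ⟨p - 1, by omega⟩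
  obtain ⟨m, rfl⟩ : ∃ m, n = m + 2 := ⟨n - 2, by omega⟩
  have h1 : q ^ (m + 1) < (q + 1) ^ (m + 1) := Nat.pow_lt_pow_left q.lt_succ_self m.succ_ne_zero
  have h2 : 1 < (q + 1) ^ (m + 1) := Nat.one_lt_pow m.succ_ne_zero hp
  rw [Nat.add_sub_cancel, pow_succ q, pow_succ (q + 1)]
  nlinarith

/-- the measure of `W_p(ψ₀)` is `1 − (p−1)^n/(p^n−1)`, strictly between 0 and 1,
so there is no zero-one law without a condition at multiples of `p`. -/
theorem Wp_psi0_measure (n p : ℕ) (hn : 2 ≤ n) [Fact p.Prime] :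
    muP p n (Wp p n (fun q => if p ∣ q then (p : ℝ)⁻¹ else 0)) =
        1 - ((p : ENNReal) - 1) ^ n / ((p : ENNReal) ^ n - 1) ∧
      0 < muP p n (Wp p n (fun q => if p ∣ q then (p : ℝ)⁻¹ else 0)) ∧
      muP p n (Wp p n (fun q => if p ∣ q then (p : ℝ)⁻¹ else 0)) < 1 := by
  have hp : 2 ≤ p := (Fact.out : p.Prime).two_le
  have hlt : ((p : ENNReal) - 1) ^ n < (p : ENNReal) ^ n - 1 := by
    rw [lt_tsub_iff_right]
    exact_mod_cast Nat.pred_pow_add_one_lt_pow hp hn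
  have h0 : ((p : ENNReal) - 1) ^ n ≠ 0 :=
    pow_ne_zero n (tsub_pos_of_lt (by exact_mod_cast hp)).ne'
  rw [muP_Wp (by omega)]
  refine ⟨rfl, tsub_pos_of_lt ?_, ENNReal.sub_lt_self ENNReal.one_ne_top one_ne_zero ?_⟩
  · exact ENNReal.div_lt_of_lt_mul (by rwa [one_mul])
  · exact (ENNReal.div_pos h0 (by finiteness)).ne'
end

section
/- Let n ≥ 2, let p be a prime, let k ≥ 1 be an integer, and let q ≥ 1 be an integer not divisible by p. Let y ∈ ℤ^n_vis satisfy y_n = q and |y_j| ≤ q for all 1 ≤ j ≤ n (so H(y) = y_n = q). Then, with η_n(x_1,…,x_{n-1}) = (x_1,…,x_{n-1}, 1), one has {x ∈ ℤ_p^{n-1} : φ(η_n(x)) ∈ B_δ(φ(y), p^{-k})} = {x ∈ ℤ_p^{n-1} : |x_i − y_i/q|_p ≤ p^{-k} for all 1 ≤ i ≤ n−1}, where B_δ(z, r) := {w ∈ ℙ^{n-1}(ℚ_p) : δ_p(w, z) ≤ r}. -/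
open MeasureTheory

theorem padicDelta_smul_left (p : ℕ) [Fact p.Prime] {n : ℕ} {a : ℚ_[p]} (ha : a ≠ 0)
    (x y : Fin n → ℚ_[p]) : padicDelta p (a • x) y = padicDelta p x y := by
  have h (ij : Fin n × Fin n) : ‖(a • x) ij.1 * y ij.2 - (a • x) ij.2 * y ij.1‖ =
      ‖a‖ * ‖x ij.1 * y ij.2 - x ij.2 * y ij.1‖ := by
    rw [← norm_mul]
    simp only [Pi.smul_apply, smul_eq_mul]
    congr 1
    ring
  unfold padicDelta
  simp_rw [h]
  rw [← Real.mul_iSup_of_nonneg (norm_nonneg a), norm_smul, mul_assoc,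
    mul_div_mul_left _ _ (norm_ne_zero_iff.mpr ha)]

theorem mk_mem_Bdelta_iff (p : ℕ) [Fact p.Prime] {n : ℕ} {x : Fin n → ℚ_[p]} (hx : x ≠ 0)
    (y : Fin n → ℚ_[p]) (r : ℝ) :
    Projectivization.mk ℚ_[p] x hx ∈ Bdelta p y r ↔ padicDelta p x y ≤ r := by
  obtain ⟨a, ha⟩ := Projectivization.exists_smul_eq_mk_rep ℚ_[p] x hx
  change padicDelta p (Projectivization.mk ℚ_[p] x hx).rep y ≤ r ↔ _
  rw [← ha, Units.smul_def, padicDelta_smul_left p a.ne_zero]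

theorem norm_eq_one_of_apply_norm_eq_one {ι E : Type*} [Fintype ι] [SeminormedAddCommGroup E]
    {x : ι → E} (hx : ∀ i, ‖x i‖ ≤ 1) {l : ι} (hl : ‖x l‖ = 1) : ‖x‖ = 1 :=
  le_antisymm ((pi_norm_le_iff_of_nonneg zero_le_one).mpr hx) (hl ▸ norm_le_pi_norm x l)

/-- In the affine chart `x l = 1`, the projective ball around an integral vector `y` with unit
coordinate `y l` is a sup-norm ball around the dehomogenization of `y`. -/
theorem padicDelta_le_iff_s12 (p : ℕ) [Fact p.Prime] {n : ℕ} {x y : Fin n → ℚ_[p]}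
    (hx : ∀ i, ‖x i‖ ≤ 1) (hy : ∀ i, ‖y i‖ ≤ 1) {l : Fin n} (hxl : x l = 1) (hyl : ‖y l‖ = 1)
    (r : ℝ) : padicDelta p x y ≤ r ↔ ∀ i, ‖x i - y i / y l‖ ≤ r := by
  have hyl0 : y l ≠ 0 := norm_ne_zero_iff.mp (by simp [hyl])
  rw [padicDelta, norm_eq_one_of_apply_norm_eq_one hx (l := l) (by simp [hxl]),
    norm_eq_one_of_apply_norm_eq_one hy hyl, mul_one, div_one]
  constructor
  · intro h i
    have hi := (le_ciSup (Set.finite_range fun ij : Fin n × Fin n =>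
      ‖x ij.1 * y ij.2 - x ij.2 * y ij.1‖).bddAbove (i, l)).trans h
    have heq : x i - y i / y l = (x i * y l - x l * y i) / y l := by
      rw [hxl]
      field_simp
    rwa [heq, norm_div, hyl, div_one]
  · intro h
    have : Nonempty (Fin n × Fin n) := ⟨(l, l)⟩
    refine ciSup_le fun ⟨i, j⟩ => ?_
    have hmul (i j : Fin n) : ‖(x i - y i / y l) * y j‖ ≤ r := by
      rw [norm_mul]
      exact (mul_le_of_le_one_right (norm_nonneg _) (hy j)).trans (h i)
    have heq : x i * y j - x j * y i =
        (x i - y i / y l) * y j - (x j - y j / y l) * y i := by ring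
    rw [heq, sub_eq_add_neg]
    refine (Padic.nonarchimedean _ _).trans (max_le (hmul i j) ?_)
    rw [norm_neg]
    exact hmul j i

/-- pullback under `η_n` of a projective ball centered at a rational point of
height `y_n = q` with `p ∤ q` is a product of `p`-adic balls. -/
theorem eta_ball_pullback (m p : ℕ) (hm : 1 ≤ m) [Fact p.Prime] (k q : ℕ)
    (hk : 1 ≤ k) (hq : 1 ≤ q) (hpq : ¬ p ∣ q) (v : Fin (m + 1) → ℤ)
    (hprim : IsPrim v) (hlast : v (Fin.last m) = (q : ℤ)) (hbd : ∀ j, |v j| ≤ (q : ℤ)) :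
    {x : Fin m → ℚ_[p] | (∀ j, ‖x j‖ ≤ 1) ∧
        Projectivization.mk ℚ_[p] (Fin.snoc x (1 : ℚ_[p]))
          (fun h => one_ne_zero (α := ℚ_[p]) (by simpa using congrFun h (Fin.last m))) ∈
        Bdelta p (intPadic p v) ((p : ℝ) ^ (-(k : ℤ)))} =
      {x : Fin m → ℚ_[p] | (∀ j, ‖x j‖ ≤ 1) ∧
        ∀ i : Fin m, ‖x i - ((v i.castSucc : ℚ_[p]) / (q : ℚ_[p]))‖ ≤ (p : ℝ) ^ (-(k : ℤ))} := by
  ext x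
  simp only [Set.mem_ofPred_eq]
  refine and_congr_right fun hx => ?_
  have hq1 : ‖(q : ℚ_[p])‖ = 1 := by
    rw [Padic.norm_natCast_eq_one_iff]
    exact (Nat.Prime.coprime_iff_not_dvd Fact.out).mpr hpq
  have hlast' : intPadic p v (Fin.last m) = q := by simp [intPadic, hlast]
  rw [mk_mem_Bdelta_iff, padicDelta_le_iff_s12 p (y := intPadic p v) (l := Fin.last m)
    (Fin.lastCases (by simp) (by simpa using hx)) (fun i => Padic.norm_int_le_one (v i)) (by simp)
    (by rw [hlast', hq1]), Fin.forall_fin_succ']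
  have hq0 : (q : ℚ_[p]) ≠ 0 := norm_ne_zero_iff.mp (by simp [hq1])
  simp [hlast, hq0, intPadic]
end

section
/- Let n ≥ 2, let p be a prime, let q and r be distinct positive integers, and let k ≥ 1 be an integer with p^k > 2qr. Then there is no pair x, y ∈ ℤ^n_vis with x_n = q, |x_j| ≤ q for all j, y_n = r, |y_j| ≤ r for all j, and δ_p(φ(x), φ(y)) ≤ p^{-k}. (If all 2×2 minors x_i y_j − x_j y_i were divisible by p^k they would vanish, forcing the primitive vectors x and y to be proportional, contradicting q ≠ r.) -/
open MeasureTheory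

/-- An integer vector has sup norm at most one in `ℚ_p^n`. -/
lemma norm_intPadic_le_one (p : ℕ) [Fact p.Prime] {n : ℕ} (v : Fin n → ℤ) :
    ‖intPadic p v‖ ≤ 1 :=
  (pi_norm_le_iff_of_nonneg zero_le_one).2 fun i => Padic.norm_int_le_one (v i)

/-- The sup norm of a nonzero integer vector in `ℚ_p^n` is positive. -/
lemma norm_intPadic_pos (p : ℕ) [Fact p.Prime] {n : ℕ} {v : Fin n → ℤ} {i : Fin n}
    (hv : v i ≠ 0) : 0 < ‖intPadic p v‖ :=
  norm_pos_iff.2 fun h => hv <| by simpa [intPadic] using congrFun h i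

/-- If two nonzero integer vectors are at projective distance at most `p ^ (-k)`, then `p ^ k`
divides all their `2 × 2` minors. -/
lemma pow_dvd_minor_of_padicDelta_le (p : ℕ) [Fact p.Prime] {n k : ℕ} {x y : Fin n → ℤ}
    {a b : Fin n} (hx : x a ≠ 0) (hy : y b ≠ 0)
    (h : padicDelta p (intPadic p x) (intPadic p y) ≤ (p : ℝ) ^ (-(k : ℤ))) (i j : Fin n) :
    (p : ℤ) ^ k ∣ x i * y j - x j * y i := by
  have hxy := mul_pos (norm_intPadic_pos p hx) (norm_intPadic_pos p hy)
  have hle : ‖intPadic p x‖ * ‖intPadic p y‖ ≤ 1 :=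
    mul_le_one₀ (norm_intPadic_le_one p x) (norm_nonneg _) (norm_intPadic_le_one p y)
  rw [padicDelta, div_le_iff₀ hxy] at h
  have hmin := (le_ciSup (f := fun ij : Fin n × Fin n =>
    ‖intPadic p x ij.1 * intPadic p y ij.2 - intPadic p x ij.2 * intPadic p y ij.1‖)
    (Set.finite_range _).bddAbove (i, j)).trans
    (h.trans (mul_le_of_le_one_right (by positivity) hle))
  have := (Padic.norm_int_le_pow_iff_dvd (p := p) (x i * y j - x j * y i) k).1
    (by simpa [intPadic] using hmin)
  exact_mod_cast this

/-- Primitive integer vectors that are proportional by positive integers `q` and `r` have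
`q = r`. -/
lemma eq_of_isPrim_of_mul_eq {n : ℕ} {x y : Fin n → ℤ} (hx : IsPrim x) (hy : IsPrim y)
    {q r : ℕ} (h : ∀ i, x i * (r : ℤ) = y i * (q : ℤ)) : q = r := by
  have hgcd : Finset.univ.gcd (fun i => x i * (r : ℤ)) =
      Finset.univ.gcd (fun i => y i * (q : ℤ)) := by simp only [h]
  rw [Finset.gcd_mul_right, Finset.gcd_mul_right, show Finset.univ.gcd x = 1 from hx,
    show Finset.univ.gcd y = 1 from hy] at hgcd
  simpa [Int.normalize_of_nonneg] using hgcd.symm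

/-- if `p^k > 2qr` then no two visible integer points of heights `q ≠ r` have
projective distance `≤ p^{-k}`. -/
theorem no_close_pairs (n p : ℕ) (hn : 2 ≤ n) [Fact p.Prime] (q r : ℕ) (hq : 1 ≤ q)
    (hr : 1 ≤ r) (hqr : q ≠ r) (k : ℕ) (hk : 1 ≤ k) (hbig : 2 * q * r < p ^ k) :
    ¬ ∃ x y : Fin n → ℤ,
        IsPrim x ∧ x ⟨n - 1, by omega⟩ = (q : ℤ) ∧ (∀ j, |x j| ≤ (q : ℤ)) ∧
        IsPrim y ∧ y ⟨n - 1, by omega⟩ = (r : ℤ) ∧ (∀ j, |y j| ≤ (r : ℤ)) ∧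
        padicDelta p (intPadic p x) (intPadic p y) ≤ (p : ℝ) ^ (-(k : ℤ)) := by
  rintro ⟨x, y, hx, hxq, hxle, hy, hyr, hyle, hδ⟩
  refine hqr (eq_of_isPrim_of_mul_eq hx hy fun i => ?_)
  have hdvd := pow_dvd_minor_of_padicDelta_le p (a := ⟨n - 1, by omega⟩)
    (b := ⟨n - 1, by omega⟩) (by rw [hxq]; omega) (by rw [hyr]; omega) hδ i ⟨n - 1, by omega⟩
  rw [hxq, hyr] at hdvd
  have hlt : |x i * (r : ℤ) - q * y i| < (p : ℤ) ^ k := by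
    have hxi : |x i * (r : ℤ)| ≤ q * r := by
      rw [abs_mul, Nat.abs_cast]
      exact mul_le_mul_of_nonneg_right (hxle i) (by positivity)
    have hyi : |(q : ℤ) * y i| ≤ q * r := by
      rw [abs_mul, Nat.abs_cast]
      exact mul_le_mul_of_nonneg_left (hyle i) (by positivity)
    have hpow : 2 * (q : ℤ) * r < (p : ℤ) ^ k := by exact_mod_cast hbig
    linarith [abs_sub (x i * (r : ℤ)) (q * y i)]
  linarith [Int.eq_zero_of_abs_lt_dvd hdvd hlt]
end
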